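/- arXiv:2406.13888 — 5 statements merged into one kernel-verified Lean document; each statement's English description precedes it below -/
import Mathlib

section
/- Suppose the stepsizes (η_t)_{t≥0} are nonnegative and there exists a function φ : ℕ → ℝ with T·φ(T) → 0 as T → ∞ such that for every convex 1-smooth function f : ℝ → ℝ attaining its infimum at some x*, and every initialization x₀ ∈ ℝ, the gradient descent iterates satisfy f(x_T) − f(x*) ≤ φ(T)·(x₀ − x*)² for all T ∈ ℕ. Then limsup_{t→∞} η_t = ∞. -/
/-- A Huber-type function: `y ↦ y² / 2` for `y ≤ δ`, continued affinely with slope `δ`. -/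
noncomputable def halfHuber (δ y : ℝ) : ℝ := y ^ 2 / 2 - max (y - δ) 0 ^ 2 / 2

theorem abs_halfHuber_sub_linear_le (δ y z : ℝ) :
    |halfHuber δ z - halfHuber δ y - (z - y) * min y δ| ≤ (z - y) ^ 2 := by
  unfold halfHuber
  rcases le_total y δ with hy | hy <;> rcases le_total z δ with hz | hz <;>
    simp only [min_eq_left, min_eq_right, max_eq_left, max_eq_right, sub_nonneg, sub_nonpos,
      hy, hz] <;> rw [abs_le] <;> constructor <;>
    nlinarith [sq_nonneg (z - y), mul_nonneg (sub_nonneg.2 hy) (sub_nonneg.2 hz)]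

theorem hasDerivAt_halfHuber (δ y : ℝ) : HasDerivAt (halfHuber δ) (min y δ) y := by
  rw [hasDerivAt_iff_isLittleO]
  refine Asymptotics.IsBigO.trans_isLittleO (g := fun z => ‖z - y‖ ^ 2) ?_
    (Asymptotics.isLittleO_pow_sub_sub y one_lt_two)
  refine Asymptotics.IsBigO.of_bound 1 (Filter.Eventually.of_forall fun z => ?_)
  simpa using abs_halfHuber_sub_linear_le δ y z

theorem deriv_halfHuber (δ y : ℝ) : deriv (halfHuber δ) y = min y δ :=
  (hasDerivAt_halfHuber δ y).deriv

theorem differentiable_halfHuber (δ : ℝ) : Differentiable ℝ (halfHuber δ) :=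
  fun y => (hasDerivAt_halfHuber δ y).differentiableAt

theorem convexOn_halfHuber (δ : ℝ) : ConvexOn ℝ Set.univ (halfHuber δ) := by
  refine Monotone.convexOn_univ_of_deriv (differentiable_halfHuber δ) fun y z hyz => ?_
  simpa only [deriv_halfHuber] using min_le_min_right δ hyz

theorem abs_deriv_halfHuber_sub_le (δ y z : ℝ) :
    |deriv (halfHuber δ) y - deriv (halfHuber δ) z| ≤ |y - z| := by
  simpa [deriv_halfHuber] using abs_min_sub_min_le_max y δ z δ

theorem halfHuber_zero {δ : ℝ} (hδ : 0 ≤ δ) : halfHuber δ 0 = 0 := by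
  simp [halfHuber, hδ]

theorem halfHuber_nonneg {δ : ℝ} (hδ : 0 ≤ δ) (y : ℝ) : 0 ≤ halfHuber δ y := by
  unfold halfHuber
  rcases le_total y δ with hy | hy
  · rw [max_eq_right (sub_nonpos.2 hy)]
    nlinarith [sq_nonneg y]
  · rw [max_eq_left (sub_nonneg.2 hy)]
    nlinarith

/-- While gradient descent stays in the region `δ ≤ y`, it moves at the constant speed `δ`. -/
theorem gradientDescent_halfHuber_eq {η : ℕ → ℝ} (hη : ∀ t, 0 ≤ η t) {δ : ℝ} (hδ : 0 ≤ δ)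
    {x : ℕ → ℝ} (hx : ∀ t, x (t + 1) = x t - η t * deriv (halfHuber δ) (x t)) {T : ℕ}
    (hT : δ ≤ x 0 - δ * ∑ t ∈ Finset.range T, η t) :
    x T = x 0 - δ * ∑ t ∈ Finset.range T, η t := by
  induction T with
  | zero => simp
  | succ T ih =>
    rw [Finset.sum_range_succ] at hT ⊢
    have hle : δ ≤ x 0 - δ * ∑ t ∈ Finset.range T, η t := by
      nlinarith [mul_nonneg hδ (hη T)]
    rw [hx, deriv_halfHuber, ih hle, min_eq_right hle]
    ring

/-- No gradient descent rate beats the inverse of the total step length. -/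
theorem inv_sum_stepsizes_le_rate {η : ℕ → ℝ} (hη : ∀ t, 0 ≤ η t) {φ : ℕ → ℝ}
    (hbound : ∀ f : ℝ → ℝ, ConvexOn ℝ Set.univ f → Differentiable ℝ f →
      (∀ y z : ℝ, |deriv f y - deriv f z| ≤ 1 * |y - z|) →
      ∀ xstar : ℝ, (∀ y : ℝ, f xstar ≤ f y) →
      ∀ x₀ : ℝ, ∀ x : ℕ → ℝ, x 0 = x₀ →
        (∀ t : ℕ, x (t + 1) = x t - η t * deriv f (x t)) →
        ∀ T : ℕ, f (x T) - f xstar ≤ φ T * (x₀ - xstar) ^ 2) (T : ℕ) :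
    1 / (8 * (∑ t ∈ Finset.range T, η t + 1)) ≤ φ T := by
  set S := ∑ t ∈ Finset.range T, η t with hS
  have hS0 : 0 ≤ S := Finset.sum_nonneg fun t _ => hη t
  obtain ⟨δ, hδ⟩ : ∃ δ : ℝ, δ = 1 / (2 * (S + 1)) := ⟨_, rfl⟩
  have hδ0 : 0 < δ := by rw [hδ]; positivity
  have hδS : δ * S + δ = 1 / 2 := by rw [hδ]; field_simp
  have hmul : 0 ≤ δ * S := by positivity
  let x : ℕ → ℝ := Nat.rec 1 fun t y => y - η t * deriv (halfHuber δ) y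
  have hx0 : x 0 = 1 := rfl
  have hxT : x T = 1 - δ * S :=
    gradientDescent_halfHuber_eq hη hδ0.le (x := x) (fun _ => rfl) (by rw [hx0, ← hS]; linarith)
  have h := hbound (halfHuber δ) (convexOn_halfHuber δ) (differentiable_halfHuber δ)
    (fun y z => by simpa using abs_deriv_halfHuber_sub_le δ y z) 0
    (fun y => by simpa [halfHuber_zero hδ0.le] using halfHuber_nonneg hδ0.le y)
    1 x hx0 (fun _ => rfl) T
  rw [halfHuber_zero hδ0.le, hxT, halfHuber, max_eq_left (by linarith)] at h
  have hrate : 1 / (8 * (S + 1)) = δ / 4 := by rw [hδ]; field_simp; norm_num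
  rw [hrate]
  nlinarith


/-- **Theorem 1 (anytime acceleration requires unbounded stepsizes).**
If gradient descent with nonnegative stepsizes `η` satisfies, for every convex
`1`-smooth `f : ℝ → ℝ` attaining its infimum and every initialization, the anytime
bound `f (x T) - f x* ≤ φ T * (x₀ - x*)²` with `T * φ T → 0`, then
`limsup η = ∞`, i.e. for every `M` we have `η t ≥ M` frequently. -/
theorem gd_anytime_acceleration_requires_unbounded_steps
    (η : ℕ → ℝ) (hη : ∀ t, 0 ≤ η t) (φ : ℕ → ℝ)
    (hφ : Filter.Tendsto (fun T : ℕ => (T : ℝ) * φ T) Filter.atTop (nhds 0))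
    (hbound : ∀ f : ℝ → ℝ, ConvexOn ℝ Set.univ f → Differentiable ℝ f →
      (∀ y z : ℝ, |deriv f y - deriv f z| ≤ 1 * |y - z|) →
      ∀ xstar : ℝ, (∀ y : ℝ, f xstar ≤ f y) →
      ∀ x₀ : ℝ, ∀ x : ℕ → ℝ, x 0 = x₀ →
        (∀ t : ℕ, x (t + 1) = x t - η t * deriv f (x t)) →
        ∀ T : ℕ, f (x T) - f xstar ≤ φ T * (x₀ - xstar) ^ 2) :
    ∀ M : ℝ, ∃ᶠ t in Filter.atTop, M ≤ η t := by
  intro M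
  by_contra hM
  rw [Filter.not_frequently] at hM
  have hbdd : BddAbove (Set.range η) :=
    Filter.IsBoundedUnder.bddAbove_range
      ⟨M, Filter.eventually_map.2 (hM.mono fun t ht => (not_le.1 ht).le)⟩
  obtain ⟨B, hB⟩ := hbdd
  have hηB : ∀ t, η t ≤ B := fun t => hB ⟨t, rfl⟩
  have hB0 : 0 ≤ B := (hη 0).trans (hηB 0)
  have hpos : 0 < 1 / (8 * (B + 1)) := by positivity
  obtain ⟨T, hsmall, hT⟩ :=
    ((hφ.eventually_lt_const hpos).and (Filter.eventually_ge_atTop 1)).exists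
  have hT1 : (1 : ℝ) ≤ T := by exact_mod_cast hT
  have hS0 : 0 ≤ ∑ t ∈ Finset.range T, η t := Finset.sum_nonneg fun t _ => hη t
  have hS : ∑ t ∈ Finset.range T, η t ≤ T * B := by
    simpa using Finset.sum_le_card_nsmul (Finset.range T) η B fun t _ => hηB t
  have hlower : 1 / (8 * (B + 1)) ≤ T * (1 / (8 * (∑ t ∈ Finset.range T, η t + 1))) := by
    rw [mul_one_div, div_le_div_iff₀ (by positivity) (by positivity)]
    nlinarith
  have hrate := mul_le_mul_of_nonneg_left (inv_sum_stepsizes_le_rate hη hbound T)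
    (zero_le_one.trans hT1)
  linarith
end

section
/- Let L > 0, let (η_t)_{t≥0} be nonnegative stepsizes, and let T ∈ ℕ satisfy η_T/2 ≥ 1/L and ∑_{t=0}^{T−1} η_t ≥ 1/L. Then there exist a convex L-smooth function f : ℝ → ℝ, a global minimizer x* of f, and an initialization x₀ ∈ ℝ such that the gradient descent iterates satisfy f(x_{T+1}) − f(x*) ≥ (1/32)·L·(x₀ − x*)²·(η_T / ∑_{t=0}^{T−1} η_t)². -/
/-- The one-sided Huber function: `L / 2 * x ^ 2` for `x ≤ 1`, affine with slope `L` for `1 ≤ x`. -/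
noncomputable def oneSidedHuber (L x : ℝ) : ℝ := L / 2 * (x ^ 2 - max (x - 1) 0 ^ 2)

theorem hasDerivAt_max_zero_sq (x : ℝ) :
    HasDerivAt (fun y : ℝ => max y 0 ^ 2) (2 * max x 0) x := by
  have of_ne : ∀ y : ℝ, y ≠ 0 → HasDerivAt (fun y : ℝ => max y 0 ^ 2) (2 * max y 0) y := by
    intro y hy
    rcases lt_or_gt_of_ne hy with h | h
    · rw [max_eq_right h.le, mul_zero]
      refine (hasDerivAt_const y (0 : ℝ)).congr_of_eventuallyEq ?_
      filter_upwards [Iio_mem_nhds h] with z hz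
      simp [max_eq_right (Set.mem_Iio.1 hz).le]
    · rw [max_eq_left h.le]
      have hd : HasDerivAt (fun y : ℝ => y ^ 2) (2 * y) y := by simpa using hasDerivAt_pow 2 y
      refine hd.congr_of_eventuallyEq ?_
      filter_upwards [Ioi_mem_nhds h] with z hz
      simp [max_eq_left (Set.mem_Ioi.1 hz).le]
  by_cases hx : x = 0
  · subst hx
    exact hasDerivAt_of_hasDerivAt_of_ne (g := fun y : ℝ => 2 * max y 0) of_ne
      (by fun_prop) (by fun_prop)
  · exact of_ne x hx

theorem hasDerivAt_oneSidedHuber (L x : ℝ) :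
    HasDerivAt (oneSidedHuber L) (L * min x 1) x := by
  have hmax : HasDerivAt (fun y : ℝ => max (y - 1) 0 ^ 2) (2 * max (x - 1) 0) x :=
    (hasDerivAt_max_zero_sq (x - 1)).comp_sub_const x 1
  have hd := ((hasDerivAt_pow 2 x).sub hmax).const_mul (L / 2)
  refine hd.congr_deriv ?_
  rcases le_total x 1 with h | h
  · rw [max_eq_right (by linarith), min_eq_left h]; norm_num; ring
  · rw [max_eq_left (by linarith), min_eq_right h]; norm_num; ring

theorem deriv_oneSidedHuber (L : ℝ) : deriv (oneSidedHuber L) = fun x => L * min x 1 :=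
  funext fun x => (hasDerivAt_oneSidedHuber L x).deriv

theorem differentiable_oneSidedHuber (L : ℝ) : Differentiable ℝ (oneSidedHuber L) :=
  fun x => (hasDerivAt_oneSidedHuber L x).differentiableAt

theorem convexOn_oneSidedHuber {L : ℝ} (hL : 0 ≤ L) :
    ConvexOn ℝ Set.univ (oneSidedHuber L) := by
  refine Monotone.convexOn_univ_of_deriv (differentiable_oneSidedHuber L) ?_
  rw [deriv_oneSidedHuber]
  intro a b hab
  dsimp only
  gcongr

theorem abs_deriv_oneSidedHuber_sub_le {L : ℝ} (hL : 0 ≤ L) (y z : ℝ) :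
    |deriv (oneSidedHuber L) y - deriv (oneSidedHuber L) z| ≤ L * |y - z| := by
  rw [deriv_oneSidedHuber]
  dsimp only
  rw [← mul_sub, abs_mul, abs_of_nonneg hL]
  refine mul_le_mul_of_nonneg_left ?_ hL
  simpa using abs_min_sub_min_le_max y 1 z 1

theorem oneSidedHuber_of_le_one (L : ℝ) {x : ℝ} (hx : x ≤ 1) :
    oneSidedHuber L x = L / 2 * x ^ 2 := by
  simp [oneSidedHuber, max_eq_right (sub_nonpos.2 hx)]

theorem oneSidedHuber_nonneg {L : ℝ} (hL : 0 ≤ L) (x : ℝ) : 0 ≤ oneSidedHuber L x := by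
  refine mul_nonneg (by linarith) ?_
  rcases le_total x 1 with h | h
  · rw [max_eq_right (by linarith)]; nlinarith
  · rw [max_eq_left (by linarith)]; nlinarith

/-- The overshooting bound with an initialization that is not itself the minimizer. -/
theorem exists_gd_overshoot_of_ne
    (L : ℝ) (hL : 0 < L) (η : ℕ → ℝ) (hη : ∀ t, 0 ≤ η t) (T : ℕ)
    (h1 : 1 / L ≤ η T / 2) (h2 : 1 / L ≤ ∑ t ∈ Finset.range T, η t) :
    ∃ f : ℝ → ℝ, ConvexOn ℝ Set.univ f ∧ Differentiable ℝ f ∧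
      (∀ y z : ℝ, |deriv f y - deriv f z| ≤ L * |y - z|) ∧
      ∃ xstar : ℝ, (∀ y : ℝ, f xstar ≤ f y) ∧
      ∃ x₀ : ℝ, x₀ ≠ xstar ∧ ∃ x : ℕ → ℝ, x 0 = x₀ ∧
        (∀ t : ℕ, x (t + 1) = x t - η t * deriv f (x t)) ∧
        (1 / 32) * L * (x₀ - xstar) ^ 2 *
            (η T / ∑ t ∈ Finset.range T, η t) ^ 2 ≤ f (x (T + 1)) - f xstar := by
  set S := ∑ t ∈ Finset.range T, η t with hS
  have hSpos : 0 < S := lt_of_lt_of_le (by positivity) h2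
  have hLS : 1 ≤ L * S := by rwa [div_le_iff₀' hL] at h2
  have hLη : 2 ≤ L * η T := by rw [div_le_iff₀' hL] at h1; linarith
  have hzero : oneSidedHuber L 0 = 0 := by
    rw [oneSidedHuber_of_le_one L zero_le_one]; ring
  let x : ℕ → ℝ := fun t => Nat.rec (1 + L * S)
    (fun t y => y - η t * deriv (oneSidedHuber L) y) t
  have hstep : ∀ t, x (t + 1) = x t - η t * deriv (oneSidedHuber L) (x t) := fun _ => rfl
  have hx : ∀ t ≤ T, x t = 1 + L * (S - ∑ i ∈ Finset.range t, η i) := by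
    intro t
    induction t with
    | zero => intro _; simp [x]
    | succ t ih =>
      intro ht
      have hxt := ih (by omega)
      have hle : ∑ i ∈ Finset.range t, η i ≤ S :=
        Finset.sum_le_sum_of_subset_of_nonneg (Finset.range_mono (by omega))
          fun i _ _ => hη i
      have hone : 1 ≤ x t := by
        rw [hxt]; linarith [mul_nonneg hL.le (sub_nonneg.2 hle)]
      rw [hstep, deriv_oneSidedHuber]
      dsimp only
      rw [min_eq_right hone, hxt, Finset.sum_range_succ]
      ring
  have hxT : x T = 1 := by rw [hx T le_rfl]; simp [hS]
  have hlast : x (T + 1) = 1 - L * η T := by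
    rw [hstep, hxT, deriv_oneSidedHuber]
    simp [mul_comm]
  refine ⟨oneSidedHuber L, convexOn_oneSidedHuber hL.le, differentiable_oneSidedHuber L,
    abs_deriv_oneSidedHuber_sub_le hL.le, 0,
    fun y => hzero.le.trans (oneSidedHuber_nonneg hL.le y), 1 + L * S, by positivity, x, rfl,
    hstep, ?_⟩
  rw [hlast, hzero, oneSidedHuber_of_le_one L (by linarith)]
  have hratio : (1 + L * S) * (η T / S) ≤ 2 * (L * η T) := by
    rw [mul_div_assoc', div_le_iff₀ hSpos]
    nlinarith [mul_le_mul_of_nonneg_right hLS (hη T)]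
  have hsq : ((1 + L * S) * (η T / S)) ^ 2 ≤ (2 * (L * η T)) ^ 2 :=
    pow_le_pow_left₀ (mul_nonneg (by positivity) (div_nonneg (hη T) hSpos.le)) hratio 2
  calc 1 / 32 * L * (1 + L * S - 0) ^ 2 * (η T / S) ^ 2
      = L / 32 * ((1 + L * S) * (η T / S)) ^ 2 := by ring
    _ ≤ L / 32 * (2 * (L * η T)) ^ 2 := by gcongr
    _ = L / 2 * (L * η T / 2) ^ 2 := by ring
    _ ≤ L / 2 * (L * η T - 1) ^ 2 := by gcongr; linarith
    _ = L / 2 * (1 - L * η T) ^ 2 - 0 := by ring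

/-- **Theorem 2 (long steps can overshoot).**
For `L > 0`, nonnegative stepsizes `η`, and `T` with `η T / 2 ≥ 1/L` and
`∑_{t<T} η t ≥ 1/L`, there is a convex `L`-smooth `f : ℝ → ℝ`, a global minimizer
`x*`, and an initialization `x₀` such that the GD iterates satisfy
`f (x (T+1)) - f x* ≥ (1/32) L (x₀ - x*)² (η T / ∑_{t<T} η t)²`. -/
theorem gd_long_step_overshoot
    (L : ℝ) (hL : 0 < L) (η : ℕ → ℝ) (hη : ∀ t, 0 ≤ η t) (T : ℕ)
    (h1 : 1 / L ≤ η T / 2) (h2 : 1 / L ≤ ∑ t ∈ Finset.range T, η t) :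
    ∃ f : ℝ → ℝ, ConvexOn ℝ Set.univ f ∧ Differentiable ℝ f ∧
      (∀ y z : ℝ, |deriv f y - deriv f z| ≤ L * |y - z|) ∧
      ∃ xstar : ℝ, (∀ y : ℝ, f xstar ≤ f y) ∧
      ∃ x₀ : ℝ, ∃ x : ℕ → ℝ, x 0 = x₀ ∧
        (∀ t : ℕ, x (t + 1) = x t - η t * deriv f (x t)) ∧
        (1 / 32) * L * (x₀ - xstar) ^ 2 *
            (η T / ∑ t ∈ Finset.range T, η t) ^ 2 ≤ f (x (T + 1)) - f xstar := by
  obtain ⟨f, hconv, hdiff, hlip, xstar, hmin, x₀, -, hgd⟩ :=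
    exists_gd_overshoot_of_ne L hL η hη T h1 h2
  exact ⟨f, hconv, hdiff, hlip, xstar, hmin, x₀, hgd⟩
end

section
/- Let (η_t)_{t≥0} be nonnegative stepsizes, T ∈ ℕ with Σ_T := ∑_{t=0}^{T−1} η_t > 0, and suppose η_t ≤ Σ_T/2 for all t < T. Define f_T : ℝ → ℝ by f_T(x) = x²/(2·Σ_T). Then the gradient descent iterates on f_T starting from x₀ = 1 satisfy f_T(x_T) ≥ e^{−4}/(2·Σ_T). -/
theorem exp_neg_two_mul_le_one_sub {u : ℝ} (h0 : 0 ≤ u) (h1 : u ≤ 1 / 2) :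
    Real.exp (-(2 * u)) ≤ 1 - u := by
  rw [Real.exp_neg]
  refine inv_le_of_inv_le₀ (by linarith) ?_
  calc (1 - u)⁻¹ ≤ 2 * u + 1 := by
        rw [inv_le_iff_one_le_mul₀ (by linarith)]
        nlinarith
    _ ≤ Real.exp (2 * u) := Real.add_one_le_exp _

theorem deriv_sq_div_two_mul (S y : ℝ) :
    deriv (fun y : ℝ => y ^ 2 / (2 * S)) y = y / S := by
  simp only [deriv_div_const, deriv_pow_field]
  rw [Nat.cast_ofNat, pow_one, mul_div_mul_left _ _ two_ne_zero]

/-- **Lower bound on the value of GD on the quadratic `f_T` (proof of Theorem 1).**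
If `Σ_T = ∑_{t<T} η t > 0`, the stepsizes are nonnegative, and `η t ≤ Σ_T / 2` for
all `t < T`, then the GD iterates on `f_T(x) = x² / (2 Σ_T)` from `x₀ = 1` satisfy
`f_T (x T) ≥ e⁻⁴ / (2 Σ_T)`. -/
theorem gd_quadratic_value_lower_bound
    (η : ℕ → ℝ) (hη : ∀ t, 0 ≤ η t) (T : ℕ)
    (hS : 0 < ∑ t ∈ Finset.range T, η t)
    (hsmall : ∀ t < T, η t ≤ (∑ s ∈ Finset.range T, η s) / 2)
    (x : ℕ → ℝ) (hx0 : x 0 = 1)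
    (hx : ∀ t : ℕ, x (t + 1) =
      x t - η t * deriv (fun y : ℝ => y ^ 2 / (2 * ∑ s ∈ Finset.range T, η s)) (x t)) :
    Real.exp (-4) / (2 * ∑ t ∈ Finset.range T, η t) ≤
      (x T) ^ 2 / (2 * ∑ t ∈ Finset.range T, η t) := by
  simp only [deriv_sq_div_two_mul] at hx
  set S := ∑ t ∈ Finset.range T, η t with hSdef
  have lower : ∀ t ≤ T, Real.exp (-(2 * ((∑ s ∈ Finset.range t, η s) / S))) ≤ x t := by
    intro t
    induction t with
    | zero => simp [hx0]
    | succ t ih =>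
      intro ht
      have hu : η t / S ≤ 1 / 2 := by
        rw [div_le_iff₀ hS]
        linarith [hsmall t ht]
      have hstep := exp_neg_two_mul_le_one_sub (div_nonneg (hη t) hS.le) hu
      have hxt := ih (Nat.le_of_succ_le ht)
      calc Real.exp (-(2 * ((∑ s ∈ Finset.range (t + 1), η s) / S)))
          = Real.exp (-(2 * ((∑ s ∈ Finset.range t, η s) / S))) *
              Real.exp (-(2 * (η t / S))) := by
            rw [← Real.exp_add, Finset.sum_range_succ]
            ring_nf
        _ ≤ x t * (1 - η t / S) :=
            mul_le_mul hxt hstep (Real.exp_pos _).le ((Real.exp_pos _).le.trans hxt)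
        _ = x (t + 1) := by
            rw [hx]
            ring
  have hT := lower T le_rfl
  rw [← hSdef, div_self hS.ne', mul_one] at hT
  gcongr
  calc Real.exp (-4) = Real.exp (-2) ^ 2 := by
        rw [← Real.exp_nat_mul]
        norm_num
    _ ≤ x T ^ 2 := by gcongr
end

section
/- Let (η_t)_{t≥0} be nonnegative stepsizes, T ∈ ℕ, Σ_T := ∑_{t=0}^{T−1} η_t, let a, r > 0, and let f be the scaled Huber function with parameters a, r. Then the gradient descent iterates on f starting from x₀ = r + a·r·Σ_T satisfy x_t = r + a·r·(Σ_T − ∑_{j=0}^{t−1} η_j) for all 0 ≤ t ≤ T; in particular x_T = r, and consequently x_{T+1} = r·(1 − a·η_T). -/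
/-- On the half-line `r ≤ y`, the scaled Huber function has derivative `a * r`. -/
theorem hasDerivAt_huber_of_le (a : ℝ) {r y : ℝ} (hy : r ≤ y) :
    HasDerivAt
      (fun y : ℝ => if y ≤ r then a / 2 * y ^ 2 else a * r * y - a * r ^ 2 / 2) (a * r) y := by
  have hlin : ∀ z : ℝ, HasDerivAt (fun y : ℝ => a * r * y - a * r ^ 2 / 2) (a * r) z := fun z => by
    simpa using ((hasDerivAt_id z).const_mul (a * r)).sub_const (a * r ^ 2 / 2)
  rcases hy.lt_or_eq with h | rfl
  · refine (hlin y).congr_of_eventuallyEq ?_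
    filter_upwards [lt_mem_nhds h] with z hz
    exact if_neg hz.not_ge
  · have hquad : HasDerivAt (fun y : ℝ => a / 2 * y ^ 2) (a * r) r := by
      refine ((hasDerivAt_pow 2 r).const_mul (a / 2)).congr_deriv ?_
      norm_num
      ring
    rw [← hasDerivWithinAt_univ, ← Set.Iic_union_Ici (a := r)]
    refine HasDerivWithinAt.union ?_ ?_
    · exact hquad.hasDerivWithinAt.congr (fun z hz => if_pos hz) (if_pos le_rfl)
    · have heq : ∀ z ∈ Set.Ici r,
          (if z ≤ r then a / 2 * z ^ 2 else a * r * z - a * r ^ 2 / 2) =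
            a * r * z - a * r ^ 2 / 2 := by
        intro z hz
        split_ifs with hzr
        · obtain rfl := le_antisymm hzr hz
          ring
        · rfl
      exact (hlin r).hasDerivWithinAt.congr heq (heq r Set.self_mem_Ici)

/-- **GD trajectory on the scaled Huber function (proof of Theorem 2).**
With nonnegative stepsizes `η`, `Σ_T = ∑_{t<T} η t`, parameters `a, r > 0`, and the
scaled Huber function `f`, the GD iterates from `x₀ = r + a r Σ_T` satisfy
`x t = r + a r (Σ_T - ∑_{j<t} η j)` for all `t ≤ T`; in particular `x T = r` and
consequently `x (T+1) = r (1 - a η T)`. -/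
theorem gd_huber_trajectory
    (η : ℕ → ℝ) (hη : ∀ t, 0 ≤ η t) (T : ℕ) (a r : ℝ) (ha : 0 < a) (hr : 0 < r)
    (x : ℕ → ℝ)
    (hx0 : x 0 = r + a * r * ∑ t ∈ Finset.range T, η t)
    (hx : ∀ t : ℕ, x (t + 1) =
      x t - η t * deriv
        (fun y : ℝ => if y ≤ r then a / 2 * y ^ 2 else a * r * y - a * r ^ 2 / 2) (x t)) :
    (∀ t ≤ T, x t = r + a * r *
        ((∑ j ∈ Finset.range T, η j) - ∑ j ∈ Finset.range t, η j)) ∧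
    x T = r ∧ x (T + 1) = r * (1 - a * η T) := by
  have htraj : ∀ t ≤ T, x t = r + a * r *
      ((∑ j ∈ Finset.range T, η j) - ∑ j ∈ Finset.range t, η j) := by
    intro t
    induction t with
    | zero => intro _; simpa using hx0
    | succ t ih =>
      intro ht
      have hxt := ih (Nat.le_of_succ_le ht)
      have hsum : ∑ j ∈ Finset.range t, η j ≤ ∑ j ∈ Finset.range T, η j :=
        Finset.sum_le_sum_of_subset_of_nonneg
          (Finset.range_subset_range.2 (Nat.le_of_succ_le ht)) fun j _ _ => hη j
      have hrx : r ≤ x t := by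
        rw [hxt]
        exact le_add_of_nonneg_right (mul_nonneg (mul_pos ha hr).le (sub_nonneg.2 hsum))
      rw [hx t, (hasDerivAt_huber_of_le a hrx).deriv, hxt, Finset.sum_range_succ]
      ring
  have hxT : x T = r := by simpa using htraj T le_rfl
  refine ⟨htraj, hxT, ?_⟩
  rw [hx T, (hasDerivAt_huber_of_le a hxT.ge).deriv, hxT]
  ring
end

section
/- Let (η_t)_{t≥0} be nonnegative reals and T ∈ ℕ with η_T ≥ 2 and Σ_T := ∑_{t=0}^{T−1} η_t ≥ 1, and set c_T := η_T²/(32·Σ_T²). Suppose a, r > 0 satisfy max{ 2/η_T , (8·c_T/(η_T²·r²))^{1/3} } ≤ a ≤ min{ 1 , (1−r)/(r·Σ_T) }. Then (a/2)·r²·(1 − a·η_T)² ≥ c_T·(r + a·r·Σ_T)². -/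
/-- **Final chain of inequalities (⋆), (⋆⋆), (⋆⋆⋆) in the proof of Theorem 2.**
If `η T ≥ 2`, `Σ_T = ∑_{t<T} η t ≥ 1`, `c_T = η T ^ 2 / (32 Σ_T ^ 2)`, and
`a, r > 0` satisfy the conclusion of Lemma 1, then
`(a/2) r² (1 - a η T)² ≥ c_T (r + a r Σ_T)²`. -/
theorem huber_final_inequality
    (η : ℕ → ℝ) (hη : ∀ t, 0 ≤ η t) (T : ℕ)
    (hηT : 2 ≤ η T) (hS : 1 ≤ ∑ t ∈ Finset.range T, η t)
    (a r : ℝ) (ha : 0 < a) (hr : 0 < r)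
    (hlow : max (2 / η T)
        ((8 * (η T ^ 2 / (32 * (∑ t ∈ Finset.range T, η t) ^ 2)) /
            (η T ^ 2 * r ^ 2)) ^ ((1 : ℝ) / 3)) ≤ a)
    (hhigh : a ≤ min 1 ((1 - r) / (r * ∑ t ∈ Finset.range T, η t))) :
    (η T ^ 2 / (32 * (∑ t ∈ Finset.range T, η t) ^ 2)) *
        (r + a * r * ∑ t ∈ Finset.range T, η t) ^ 2 ≤
      a / 2 * r ^ 2 * (1 - a * η T) ^ 2 := by
  set S := ∑ t ∈ Finset.range T, η t
  set c := η T ^ 2 / (32 * S ^ 2)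
  have hη0 : 0 < η T := by linarith
  have hS0 : 0 < S := by linarith
  have hc : 0 ≤ c := by positivity
  obtain ⟨h2, h8⟩ := max_le_iff.mp hlow
  have haη : 2 ≤ a * η T := (div_le_iff₀ hη0).mp h2
  have hdist : r + a * r * S ≤ 1 := by
    have := (le_div_iff₀ (mul_pos hr hS0)).mp (hhigh.trans (min_le_right _ _))
    linarith
  have hcube : 8 * c ≤ a ^ 3 * (η T ^ 2 * r ^ 2) := by
    rw [← div_le_iff₀ (by positivity)]
    rw [one_div, Real.rpow_inv_le_iff_of_pos (by positivity) ha.le (by norm_num)] at h8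
    exact_mod_cast h8
  have hstep : (a * η T) ^ 2 / 4 ≤ (1 - a * η T) ^ 2 := by nlinarith
  calc c * (r + a * r * S) ^ 2 ≤ c * 1 :=
        mul_le_mul_of_nonneg_left (pow_le_one₀ (by positivity) hdist) hc
    _ ≤ a / 2 * r ^ 2 * ((a * η T) ^ 2 / 4) := by linarith
    _ ≤ a / 2 * r ^ 2 * (1 - a * η T) ^ 2 :=
        mul_le_mul_of_nonneg_left hstep (by positivity)
end
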